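/- arXiv:2310.04969 — 2 statements merged into one kernel-verified Lean document; each statement's English description precedes it below -/
import Mathlib

section
/- Let D be the unique ℚ-linear derivation of the polynomial ring ℚ[a,x,y,z,α] in five variables determined by D(a) = a·α·(z+y), D(x) = x·y, D(y) = x·y, D(z) = 0, D(α) = 0. Then for every n ≥ 0, D^n(a) = a · ∑_{σ∈PRW_{n+1}} x^{des(σ)−LRmin(σ)+1} y^{asc(σ)} z^{LRmin(σ)−1} α^{LRmin(σ)+RLmin(σ)−2}. -/
/-- The letter at (1-based) position `i` of the word `w`, with the boundary
convention that positions `0` and `> w.length` carry the value `w.length + 1`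
(playing the role of `+∞` for a permutation word of `{1,…,n}`). -/
def wB (w : List ℕ) (i : ℕ) : ℕ :=
  if 1 ≤ i ∧ i ≤ w.length then w.getD (i - 1) 0 else w.length + 1

/-- The one-line word `σ_1 ⋯ σ_n` (with letters in `{1,…,n}`) of a permutation of `Fin n`. -/
def word {n : ℕ} (σ : Equiv.Perm (Fin n)) : List ℕ := List.ofFn (fun i => (σ i : ℕ) + 1)

/-- Number of descents: indices `i ∈ {1,…,n-1}` with `σ_i > σ_{i+1}`. -/
def desW (w : List ℕ) : ℕ :=
  ((Finset.Icc 1 (w.length - 1)).filter (fun i => wB w (i + 1) < wB w i)).card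

/-- Number of ascents: indices `i ∈ {1,…,n-1}` with `σ_i < σ_{i+1}`. -/
def ascW (w : List ℕ) : ℕ :=
  ((Finset.Icc 1 (w.length - 1)).filter (fun i => wB w i < wB w (i + 1))).card

/-- Position `i` is a double ascent: `σ_{i-1} < σ_i < σ_{i+1}` (boundary `σ_0 = σ_{n+1} = +∞`). -/
abbrev isDAat (w : List ℕ) (i : ℕ) : Prop := wB w (i - 1) < wB w i ∧ wB w i < wB w (i + 1)

/-- Position `i` is a double descent: `σ_{i-1} > σ_i > σ_{i+1}`. -/
abbrev isDDat (w : List ℕ) (i : ℕ) : Prop := wB w i < wB w (i - 1) ∧ wB w (i + 1) < wB w i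

/-- Position `i` is a peak: `σ_{i-1} < σ_i > σ_{i+1}`. -/
abbrev isPkat (w : List ℕ) (i : ℕ) : Prop := wB w (i - 1) < wB w i ∧ wB w (i + 1) < wB w i

/-- Position `i` is a valley: `σ_{i-1} > σ_i < σ_{i+1}`. -/
abbrev isVlat (w : List ℕ) (i : ℕ) : Prop := wB w i < wB w (i - 1) ∧ wB w i < wB w (i + 1)

/-- Position `i` holds a left-to-right minimum: `σ_j > σ_i` for all `j < i`. -/
abbrev isLRat (w : List ℕ) (i : ℕ) : Prop := ∀ j ∈ Finset.Icc 1 (i - 1), wB w i < wB w j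

/-- Position `i` holds a right-to-left minimum: `σ_j > σ_i` for all `j > i`. -/
abbrev isRLat (w : List ℕ) (i : ℕ) : Prop := ∀ j ∈ Finset.Icc (i + 1) w.length, wB w i < wB w j

/-- `da`, the number of double ascents. -/
def daW (w : List ℕ) : ℕ := ((Finset.Icc 1 w.length).filter (isDAat w)).card

/-- `dd`, the number of double descents. -/
def ddW (w : List ℕ) : ℕ := ((Finset.Icc 1 w.length).filter (isDDat w)).card

/-- `M`, the number of peaks. -/
def pkW (w : List ℕ) : ℕ := ((Finset.Icc 1 w.length).filter (isPkat w)).card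

/-- `LRmin`, the number of left-to-right minima. -/
def lrminW (w : List ℕ) : ℕ := ((Finset.Icc 1 w.length).filter (isLRat w)).card

/-- `RLmin`, the number of right-to-left minima. -/
def rlminW (w : List ℕ) : ℕ := ((Finset.Icc 1 w.length).filter (isRLat w)).card

/-- The word belongs to `PRW`: if it has an ascent, the first ascent occurs at the letter `1`. -/
abbrev isPRW (w : List ℕ) : Prop :=
  ∀ i ∈ Finset.Icc 1 (w.length - 1), wB w i < wB w (i + 1) →
    (∀ j ∈ Finset.Icc 1 (i - 1), ¬ wB w j < wB w (j + 1)) → wB w i = 1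

/-- The set `PRW_n` of permutations whose first ascent (if any) appears at the letter `1`. -/
def PRW (n : ℕ) : Finset (Equiv.Perm (Fin n)) :=
  Finset.univ.filter (fun σ => isPRW (word σ))

section InsertionWeights

variable {R : Type*} [CommRing R]

/-- The weight `x ^ des * y ^ asc * α ^ (RLmin - 1)` of a nonempty word. -/
def runWeight (x y α : R) : List ℕ → R
  | [] => 1
  | [_] => 1
  | a :: b :: l =>
    (if a < b then y else x) * (if ∀ c ∈ b :: l, a < c then α else 1) * runWeight x y α (b :: l)

/-- The weight of a word whose letters include `1`: each letter of the initial descending run before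
`1` contributes `z * α`, the rest contributes its `runWeight`, and words outside `PRW` have
weight `0`. -/
def prwWeight (x y z α : R) : List ℕ → R
  | [] => 1
  | [_] => 1
  | a :: b :: l =>
    if a < b then (if a = 1 then runWeight x y α (a :: b :: l) else 0)
    else z * α * prwWeight x y z α (b :: l)

variable [Algebra ℚ R] (D : Derivation ℚ R R) {x y z α : R}

theorem sum_runWeight_insertIdx (hx : D x = x * y) (hy : D y = x * y) (hα : D α = 0) {N : ℕ}
    (a : ℕ) (l : List ℕ) (hN : ∀ c ∈ a :: l, c < N) :
    ∑ p ∈ Finset.range (l.length + 1), runWeight x y α (a :: l.insertIdx p N) =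
      D (runWeight x y α (a :: l)) + α * y * runWeight x y α (a :: l) := by
  induction l generalizing a with
  | nil =>
    have : a < N := hN a (by simp)
    simp [runWeight, this, mul_comm]
  | cons b l ih =>
    have haN : a < N := hN a (by simp)
    have hbN : b < N := hN b (by simp)
    have hmin (p : ℕ) : (∀ c ∈ b :: l.insertIdx p N, a < c) ↔ ∀ c ∈ b :: l, a < c := by
      by_cases hp : p ≤ l.length
      · simp [List.mem_insertIdx hp, haN]
      · rw [List.insertIdx_of_length_lt (by omega)]
    rw [List.length_cons, Finset.sum_range_succ']
    simp only [List.insertIdx_succ_cons, List.insertIdx_zero]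
    have hsum : ∑ p ∈ Finset.range (l.length + 1),
        runWeight x y α (a :: b :: l.insertIdx p N) =
        (if a < b then y else x) * (if ∀ c ∈ b :: l, a < c then α else 1) *
          (D (runWeight x y α (b :: l)) + α * y * runWeight x y α (b :: l)) := by
      rw [← ih b (fun c hc => hN c (List.mem_cons_of_mem _ hc)), Finset.mul_sum]
      refine Finset.sum_congr rfl fun p _ => ?_
      simp only [runWeight, hmin]
    have hins : runWeight x y α (a :: N :: b :: l) =
        x * y * (if ∀ c ∈ b :: l, a < c then α else 1) * runWeight x y α (b :: l) := by
      have h₁ : ¬ (∀ c ∈ b :: l, N < c) := fun h => by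
        have := h b (by simp)
        omega
      have h₂ : (∀ c ∈ N :: b :: l, a < c) ↔ ∀ c ∈ b :: l, a < c := by simp [haN]
      simp only [runWeight, h₁, h₂, haN, hbN.not_gt, if_true, if_false]
      ring
    rw [hsum, hins]
    simp only [runWeight]
    split_ifs <;>
      simp only [Derivation.leibniz, hx, hy, hα, smul_eq_mul, Derivation.map_one_eq_zero] <;> ring

theorem sum_prwWeight_insertIdx (hx : D x = x * y) (hy : D y = x * y) (hz : D z = 0)
    (hα : D α = 0) {N : ℕ} (a : ℕ) (l : List ℕ) (hN : ∀ c ∈ a :: l, c < N)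
    (hpos : ∀ c ∈ a :: l, 1 ≤ c) (hone : 1 ∈ a :: l) (hnd : (a :: l).Nodup) :
    ∑ p ∈ Finset.range (l.length + 1), prwWeight x y z α (a :: l.insertIdx p N) =
      D (prwWeight x y z α (a :: l)) + α * y * prwWeight x y z α (a :: l) := by
  induction l generalizing a with
  | nil =>
    obtain rfl : a = 1 := by simpa [eq_comm] using hone
    have : 1 < N := hN 1 (by simp)
    simp [prwWeight, runWeight, this, mul_comm]
  | cons b l ih =>
    have haN : a < N := hN a (by simp)
    have hab : a ≠ b := by
      rintro rfl
      simp at hnd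
    by_cases ha : a = 1
    · subst ha
      have hb : 1 < b := lt_of_le_of_ne (hpos b (by simp)) hab
      have key := sum_runWeight_insertIdx D hx hy hα 1 (b :: l) hN
      rw [List.length_cons, Finset.sum_range_succ'] at key ⊢
      simpa [prwWeight, hb, haN] using key
    · rw [List.length_cons, Finset.sum_range_succ']
      simp only [List.insertIdx_succ_cons, List.insertIdx_zero, prwWeight, ha, haN, if_true, if_false]
      by_cases hlt : a < b
      · simp [hlt]
      · simp only [hlt, if_false, ← Finset.mul_sum]
        rw [ih b (fun c hc => hN c (List.mem_cons_of_mem _ hc))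
          (fun c hc => hpos c (List.mem_cons_of_mem _ hc))
          ((List.mem_cons.1 hone).resolve_left (Ne.symm ha)) hnd.of_cons]
        simp only [Derivation.leibniz, hz, hα, smul_eq_mul]
        ring

theorem sum_prwWeight_insertIdx_all (hx : D x = x * y) (hy : D y = x * y) (hz : D z = 0)
    (hα : D α = 0) {N : ℕ} (w : List ℕ) (hN : ∀ c ∈ w, c < N)
    (hpos : ∀ c ∈ w, 1 ≤ c) (hone : 1 ∈ w) (hnd : w.Nodup) :
    ∑ p ∈ Finset.range (w.length + 1), prwWeight x y z α (w.insertIdx p N) =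
      D (prwWeight x y z α w) + α * (z + y) * prwWeight x y z α w := by
  cases w with
  | nil => simp at hone
  | cons a l =>
    have haN : a < N := hN a (by simp)
    rw [List.length_cons, Finset.sum_range_succ']
    simp only [List.insertIdx_succ_cons, List.insertIdx_zero]
    rw [sum_prwWeight_insertIdx D hx hy hz hα a l hN hpos hone hnd]
    simp only [prwWeight, haN.not_gt, if_false]
    ring

end InsertionWeights

section Recursion

theorem wB_eq_getD {w : List ℕ} {i : ℕ} (h : i < w.length) : wB w (i + 1) = w.getD i 0 := by
  rw [wB, if_pos (by omega), Nat.add_sub_cancel]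

theorem wB_cons_one (a : ℕ) (l : List ℕ) : wB (a :: l) 1 = a := by
  simp [wB]

theorem wB_cons_succ (a : ℕ) {l : List ℕ} {i : ℕ} (hi : 1 ≤ i) (h : i ≤ l.length) :
    wB (a :: l) (i + 1) = wB l i := by
  obtain ⟨i, rfl⟩ := Nat.exists_eq_add_of_le' hi
  rw [wB_eq_getD (by simpa using h), wB_eq_getD h, List.getD_cons_succ]

theorem wB_mem {w : List ℕ} {i : ℕ} (hi : 1 ≤ i) (h : i ≤ w.length) : wB w i ∈ w := by
  obtain ⟨i, rfl⟩ := Nat.exists_eq_add_of_le' hi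
  rw [wB_eq_getD h, List.getD_eq_getElem _ _ h]
  exact List.getElem_mem _

theorem exists_wB_eq {w : List ℕ} {c : ℕ} (hc : c ∈ w) :
    ∃ i, 1 ≤ i ∧ i ≤ w.length ∧ wB w i = c := by
  obtain ⟨i, hi, rfl⟩ := List.getElem_of_mem hc
  exact ⟨i + 1, by omega, hi, by rw [wB_eq_getD hi, List.getD_eq_getElem _ _ hi]⟩

theorem card_filter_Icc_succ (n : ℕ) (p q : ℕ → Prop) [DecidablePred p] [DecidablePred q]
    (h : ∀ i, 1 ≤ i → i ≤ n → (p (i + 1) ↔ q i)) :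
    ((Finset.Icc 1 (n + 1)).filter p).card =
      (if p 1 then 1 else 0) + ((Finset.Icc 1 n).filter q).card := by
  have hIcc : Finset.Icc 1 (n + 1) = insert 1 ((Finset.Icc 1 n).map (addRightEmbedding 1)) := by
    rw [Finset.map_add_right_Icc, Finset.insert_Icc_add_one_left_eq_Icc (by omega)]
  simp only [Finset.card_filter]
  rw [hIcc, Finset.sum_insert (by simp), Finset.sum_map]
  congr 1
  refine Finset.sum_congr rfl fun i hi => ?_
  rw [Finset.mem_Icc] at hi
  simp [h i hi.1 hi.2]

theorem desW_cons_cons (a b : ℕ) (l : List ℕ) :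
    desW (a :: b :: l) = (if b < a then 1 else 0) + desW (b :: l) := by
  have := card_filter_Icc_succ l.length
    (fun i => wB (a :: b :: l) (i + 1) < wB (a :: b :: l) i)
    (fun i => wB (b :: l) (i + 1) < wB (b :: l) i) (fun i h₁ h₂ => by
      rw [wB_cons_succ a (by omega) (by simp; omega), wB_cons_succ a h₁ (by simp; omega)])
  rw [wB_cons_succ a le_rfl (by simp), wB_cons_one, wB_cons_one] at this
  simpa [desW] using this

theorem ascW_cons_cons (a b : ℕ) (l : List ℕ) :
    ascW (a :: b :: l) = (if a < b then 1 else 0) + ascW (b :: l) := by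
  have := card_filter_Icc_succ l.length
    (fun i => wB (a :: b :: l) i < wB (a :: b :: l) (i + 1))
    (fun i => wB (b :: l) i < wB (b :: l) (i + 1)) (fun i h₁ h₂ => by
      rw [wB_cons_succ a h₁ (by simp; omega), wB_cons_succ a (by omega) (by simp; omega)])
  rw [wB_cons_succ a le_rfl (by simp), wB_cons_one, wB_cons_one] at this
  simpa [ascW] using this

theorem isRLat_cons_one (a : ℕ) (l : List ℕ) : isRLat (a :: l) 1 ↔ ∀ c ∈ l, a < c := by
  simp only [isRLat, Finset.mem_Icc, wB_cons_one, List.length_cons]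
  constructor
  · intro h c hc
    obtain ⟨i, h₁, h₂, rfl⟩ := exists_wB_eq hc
    rw [← wB_cons_succ a h₁ h₂]
    exact h _ (by omega)
  · intro h j hj
    obtain ⟨i, rfl⟩ := Nat.exists_eq_add_of_le' (show 1 ≤ j by omega)
    rw [wB_cons_succ a (by omega) (by omega)]
    exact h _ (wB_mem (by omega) (by omega))

theorem isRLat_cons_succ (a : ℕ) {l : List ℕ} {i : ℕ} (hi : 1 ≤ i) (h : i ≤ l.length) :
    isRLat (a :: l) (i + 1) ↔ isRLat l i := by
  simp only [isRLat, Finset.mem_Icc, List.length_cons, wB_cons_succ a hi h]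
  constructor
  · intro H j hj
    rw [← wB_cons_succ a (by omega) hj.2]
    exact H _ (by omega)
  · intro H j hj
    obtain ⟨j, rfl⟩ := Nat.exists_eq_add_of_le' (show 1 ≤ j by omega)
    rw [wB_cons_succ a (by omega) (by omega)]
    exact H _ (by omega)

theorem isLRat_one (w : List ℕ) : isLRat w 1 := by
  simp [isLRat]

theorem isLRat_cons_succ (a : ℕ) {l : List ℕ} {i : ℕ} (hi : 1 ≤ i) (h : i ≤ l.length) :
    isLRat (a :: l) (i + 1) ↔ wB l i < a ∧ isLRat l i := by
  simp only [isLRat, Finset.mem_Icc, wB_cons_succ a hi h, Nat.add_sub_cancel]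
  constructor
  · intro H
    refine ⟨by simpa [wB_cons_one] using H 1 (by omega), fun j hj => ?_⟩
    rw [← wB_cons_succ a (i := j) (by omega) (by omega)]
    exact H _ (by omega)
  · rintro ⟨H₁, H₂⟩ j hj
    obtain ⟨j, rfl⟩ := Nat.exists_eq_add_of_le' hj.1
    rcases Nat.eq_zero_or_pos j with rfl | hj0
    · simpa [wB_cons_one] using H₁
    · rw [wB_cons_succ a (by omega) (by omega)]
      exact H₂ _ (by omega)

theorem rlminW_cons (a : ℕ) (l : List ℕ) :
    rlminW (a :: l) = (if ∀ c ∈ l, a < c then 1 else 0) + rlminW l := by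
  have := card_filter_Icc_succ l.length (isRLat (a :: l)) (isRLat l)
    (fun i h₁ h₂ => isRLat_cons_succ a h₁ h₂)
  simp only [isRLat_cons_one] at this
  exact this

theorem lrminW_cons_of_gt {a b : ℕ} (l : List ℕ) (hab : b < a) :
    lrminW (a :: b :: l) = 1 + lrminW (b :: l) := by
  have := card_filter_Icc_succ (l.length + 1) (isLRat (a :: b :: l)) (isLRat (b :: l))
    (fun i h₁ h₂ => by
      rw [isLRat_cons_succ a h₁ (by simpa using h₂), and_iff_right_of_imp]
      intro H
      rcases h₁.eq_or_lt with rfl | h₁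
      · rwa [wB_cons_one]
      · have := H 1 (by simp; omega)
        rw [wB_cons_one] at this
        omega)
  rwa [if_pos (isLRat_one _)] at this

theorem lrminW_one_cons {l : List ℕ} (hpos : ∀ c ∈ l, 1 ≤ c) : lrminW (1 :: l) = 1 := by
  have := card_filter_Icc_succ l.length (isLRat (1 :: l)) (fun _ => False)
    (fun i h₁ h₂ => by
      rw [isLRat_cons_succ 1 h₁ h₂, iff_false]
      have := hpos _ (wB_mem h₁ h₂)
      omega)
  rw [if_pos (isLRat_one _)] at this
  simpa [lrminW] using this

theorem isPRW_cons_cons_of_lt {a b : ℕ} (l : List ℕ) (hab : a < b) :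
    isPRW (a :: b :: l) ↔ a = 1 := by
  have h₁ : wB (a :: b :: l) 1 = a := wB_cons_one _ _
  have h₂ : wB (a :: b :: l) (1 + 1) = b := by
    rw [wB_cons_succ a le_rfl (by simp), wB_cons_one]
  constructor
  · intro H
    simpa [h₁] using H 1 (by simp) (by rwa [h₁, h₂]) (by simp)
  · intro ha i hi _ hj
    rw [Finset.mem_Icc] at hi
    rcases hi.1.eq_or_lt with rfl | hi'
    · rwa [h₁]
    · exact absurd (by rwa [h₁, h₂]) (hj 1 (by rw [Finset.mem_Icc]; omega))

theorem isPRW_cons_cons_of_gt {a b : ℕ} (l : List ℕ) (hab : b < a) :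
    isPRW (a :: b :: l) ↔ isPRW (b :: l) := by
  have h₁ : wB (a :: b :: l) 1 = a := wB_cons_one _ _
  have h₂ : wB (a :: b :: l) (1 + 1) = b := by
    rw [wB_cons_succ a le_rfl (by simp), wB_cons_one]
  have hs {i : ℕ} (h : 1 ≤ i) (h' : i ≤ l.length + 1) :
      wB (a :: b :: l) (i + 1) = wB (b :: l) i := wB_cons_succ a h (by simpa using h')
  simp only [isPRW, Finset.mem_Icc, List.length_cons, Nat.add_sub_cancel]
  constructor
  · intro H i hi hlt hj
    rw [← hs (by omega) (by omega), ← hs (by omega) (by omega)] at hlt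
    rw [← hs (by omega) (by omega)]
    refine H _ (by omega) hlt fun j hj' => ?_
    rcases hj'.1.eq_or_lt with rfl | h1
    · rw [h₁, h₂]
      omega
    · obtain ⟨j, rfl⟩ := Nat.exists_eq_add_of_le' hj'.1
      rw [hs (by omega) (by omega), hs (by omega) (by omega)]
      exact hj j (by omega)
  · intro H i hi hlt hj
    rcases hi.1.eq_or_lt with rfl | h1
    · rw [h₁, h₂] at hlt
      omega
    · obtain ⟨i, rfl⟩ := Nat.exists_eq_add_of_le' hi.1
      rw [hs (by omega) (by omega), hs (by omega) (by omega)] at hlt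
      rw [hs (by omega) (by omega)]
      refine H i (by omega) hlt fun j hj' => ?_
      rw [← hs (by omega) (by omega), ← hs (by omega) (by omega)]
      exact hj (j + 1) (by omega)

theorem rlminW_singleton (a : ℕ) : rlminW [a] = 1 := by
  rw [rlminW_cons]
  simp [rlminW]

theorem rlminW_pos (a : ℕ) (l : List ℕ) : 1 ≤ rlminW (a :: l) := by
  induction l generalizing a with
  | nil => rw [rlminW_singleton]
  | cons b l ih =>
    rw [rlminW_cons]
    exact (ih b).trans (Nat.le_add_left _ _)

variable {R : Type*} [CommRing R]

theorem runWeight_eq (x y α : R) (a : ℕ) (l : List ℕ) (hnd : (a :: l).Nodup) :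
    runWeight x y α (a :: l) =
      x ^ desW (a :: l) * y ^ ascW (a :: l) * α ^ (rlminW (a :: l) - 1) := by
  induction l generalizing a with
  | nil => simp [runWeight, desW, ascW, rlminW_singleton]
  | cons b l ih =>
    have hab : a ≠ b := by
      rintro rfl
      simp at hnd
    obtain ⟨r, hr⟩ := Nat.exists_eq_add_of_le' (rlminW_pos b l)
    rw [runWeight, ih b hnd.of_cons, desW_cons_cons, ascW_cons_cons, rlminW_cons a (b :: l), hr,
      ← Nat.add_assoc, Nat.add_sub_cancel, Nat.add_sub_cancel]
    rcases hab.lt_or_gt with h | h <;> simp only [h, h.not_gt, if_true, if_false] <;>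
      split_ifs <;> ring

theorem prwWeight_eq (x y z α : R) (a : ℕ) (l : List ℕ) (hpos : ∀ c ∈ a :: l, 1 ≤ c)
    (hone : 1 ∈ a :: l) (hnd : (a :: l).Nodup) :
    (isPRW (a :: l) → 1 ≤ lrminW (a :: l) ∧ lrminW (a :: l) ≤ desW (a :: l) + 1) ∧
    prwWeight x y z α (a :: l) = if isPRW (a :: l) then
      x ^ (desW (a :: l) + 1 - lrminW (a :: l)) * y ^ ascW (a :: l) * z ^ (lrminW (a :: l) - 1) *
        α ^ (lrminW (a :: l) + rlminW (a :: l) - 2) else 0 := by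
  induction l generalizing a with
  | nil =>
    obtain rfl : a = 1 := by simpa [eq_comm] using hone
    rw [lrminW_one_cons (by simp)]
    simp [prwWeight, desW, ascW, rlminW_singleton, isPRW]
  | cons b l ih =>
    have hab : a ≠ b := by
      rintro rfl
      simp at hnd
    rcases hab.lt_or_gt with h | h
    · simp only [isPRW_cons_cons_of_lt l h, prwWeight, h, if_true]
      by_cases ha : a = 1
      · subst ha
        rw [lrminW_one_cons (fun c hc => hpos c (List.mem_cons_of_mem _ hc)),
          runWeight_eq x y α 1 (b :: l) hnd, show 1 + rlminW (1 :: b :: l) - 2 =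
            rlminW (1 :: b :: l) - 1 by omega]
        simp
      · simp [ha]
    · have ha : a ≠ 1 := by
        have := hpos b (by simp)
        omega
      obtain ⟨ih₁, ih₂⟩ := ih b (fun c hc => hpos c (List.mem_cons_of_mem _ hc))
          ((List.mem_cons.1 hone).resolve_left (Ne.symm ha)) hnd.of_cons
      have hmin : ¬ ∀ c ∈ b :: l, a < c := fun H => h.not_gt (H b (by simp))
      simp only [isPRW_cons_cons_of_gt l h, prwWeight, h.not_gt, if_false, ih₂, desW_cons_cons,
        ascW_cons_cons, lrminW_cons_of_gt l h, rlminW_cons a, h, hmin, if_true]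
      refine ⟨fun H => by have := ih₁ H; omega, ?_⟩
      by_cases hP : isPRW (b :: l)
      · simp only [if_pos hP]
        obtain ⟨h₁, h₂⟩ := ih₁ hP
        have h₃ := rlminW_pos b l
        obtain ⟨r, hr⟩ := Nat.exists_eq_add_of_le' h₃
        obtain ⟨m, hm⟩ := Nat.exists_eq_add_of_le' h₁
        rw [show 1 + desW (b :: l) + 1 - (1 + lrminW (b :: l)) =
          desW (b :: l) + 1 - lrminW (b :: l) by omega, hr, hm,
          show m + 1 + (r + 1) - 2 = m + r by omega, show m + 1 - 1 = m by omega,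
          show 1 + (m + 1) + (0 + (r + 1)) - 2 = m + r + 1 by omega,
          show 1 + (m + 1) - 1 = m + 1 by omega]
        ring
      · simp only [if_neg hP, mul_zero]

end Recursion

section Insertion

theorem length_word {n : ℕ} (σ : Equiv.Perm (Fin n)) : (word σ).length = n := by
  simp [word]

theorem mem_word {n c : ℕ} (σ : Equiv.Perm (Fin n)) : c ∈ word σ ↔ 1 ≤ c ∧ c ≤ n := by
  rw [word, List.mem_ofFn]
  constructor
  · rintro ⟨i, rfl⟩
    exact ⟨by omega, (σ i).2⟩
  · rintro ⟨h₁, h₂⟩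
    exact ⟨σ.symm ⟨c - 1, by omega⟩, by simp; omega⟩

theorem nodup_word {n : ℕ} (σ : Equiv.Perm (Fin n)) : (word σ).Nodup := by
  refine List.nodup_ofFn.2 fun i j h => ?_
  exact σ.injective (Fin.ext (by simpa using h))

/-- Insert the new largest letter into the one-line word of `σ` at position `p`. -/
def insertMax {n : ℕ} (p : Fin (n + 1)) (σ : Equiv.Perm (Fin n)) : Equiv.Perm (Fin (n + 1)) :=
  (finSuccEquiv' p).trans ((Equiv.optionCongr σ).trans (finSuccEquiv' (Fin.last n)).symm)

theorem insertMax_self {n : ℕ} (p : Fin (n + 1)) (σ : Equiv.Perm (Fin n)) :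
    insertMax p σ p = Fin.last n := by
  simp [insertMax]

theorem insertMax_succAbove {n : ℕ} (p : Fin (n + 1)) (σ : Equiv.Perm (Fin n)) (i : Fin n) :
    insertMax p σ (p.succAbove i) = (σ i).castSucc := by
  simp [insertMax]

theorem word_insertMax {n : ℕ} (p : Fin (n + 1)) (σ : Equiv.Perm (Fin n)) :
    word (insertMax p σ) = (word σ).insertIdx p (n + 1) := by
  have hp : (p : ℕ) ≤ (word σ).length := by
    rw [length_word]
    omega
  refine List.ext_getElem (by rw [List.length_insertIdx_of_le_length hp, length_word, length_word])
    fun i h₁ h₂ => ?_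
  have hi : i < n + 1 := by rwa [length_word] at h₁
  have hw : (word (insertMax p σ))[i] = (insertMax p σ ⟨i, hi⟩ : ℕ) + 1 := by
    simp [word, -List.ofFn_succ]
  rw [hw, List.getElem_insertIdx]
  rcases Fin.eq_self_or_eq_succAbove p ⟨i, hi⟩ with h | ⟨j, hj⟩
  · rw [h, insertMax_self]
    simp [← h]
  · rw [hj, insertMax_succAbove]
    have hij : i = (p.succAbove j : ℕ) := congrArg Fin.val hj
    rw [Fin.succAbove] at hij
    split_ifs at hij with hlt
    · have : i < p := by rw [hij]; exact hlt
      simp_all [word]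
    · have : ¬ i < p := by
        rw [Fin.lt_def] at hlt
        simp at hij hlt
        omega
      have : i ≠ p := by
        rw [Fin.lt_def] at hlt
        simp at hij hlt
        omega
      simp_all [word]

theorem insertMax_bijective (n : ℕ) :
    Function.Bijective fun q : Fin (n + 1) × Equiv.Perm (Fin n) => insertMax q.1 q.2 := by
  rw [Fintype.bijective_iff_injective_and_card]
  refine ⟨?_, by simp [Fintype.card_perm, Nat.factorial_succ]⟩
  rintro ⟨p, σ⟩ ⟨q, τ⟩ h
  obtain rfl : p = q := by
    apply (insertMax q τ).injective
    rw [insertMax_self, ← insertMax_self p σ]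
    exact (DFunLike.congr_fun h p).symm
  simp only [Prod.mk.injEq, true_and]
  ext i
  have := DFunLike.congr_fun h (p.succAbove i)
  simp only [insertMax_succAbove, Fin.castSucc_inj] at this
  rw [this]

end Insertion

theorem sum_prwWeight_word_succ {R : Type*} [CommRing R] [Algebra ℚ R] (D : Derivation ℚ R R)
    {x y z α : R} (hx : D x = x * y) (hy : D y = x * y) (hz : D z = 0) (hα : D α = 0) (n : ℕ) :
    ∑ σ : Equiv.Perm (Fin (n + 2)), prwWeight x y z α (word σ) =
      D (∑ σ : Equiv.Perm (Fin (n + 1)), prwWeight x y z α (word σ)) +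
        α * (z + y) * ∑ σ : Equiv.Perm (Fin (n + 1)), prwWeight x y z α (word σ) := by
  rw [← (insertMax_bijective (n + 1)).sum_comp, Fintype.sum_prod_type_right, map_sum,
    Finset.mul_sum, ← Finset.sum_add_distrib]
  refine Finset.sum_congr rfl fun σ _ => ?_
  rw [← sum_prwWeight_insertIdx_all D hx hy hz hα (N := n + 2) (word σ)
    (fun c hc => by have := (mem_word σ).1 hc; omega) (fun c hc => ((mem_word σ).1 hc).1)
    ((mem_word σ).2 (by omega)) (nodup_word σ), length_word, Finset.sum_range]
  simp only [word_insertMax]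

theorem sum_PRW_eq_sum_prwWeight {R : Type*} [CommRing R] (x y z α : R) (n : ℕ) :
    ∑ σ ∈ PRW (n + 1), x ^ (desW (word σ) + 1 - lrminW (word σ)) * y ^ ascW (word σ) *
        z ^ (lrminW (word σ) - 1) * α ^ (lrminW (word σ) + rlminW (word σ) - 2) =
      ∑ σ : Equiv.Perm (Fin (n + 1)), prwWeight x y z α (word σ) := by
  rw [PRW, Finset.sum_filter]
  refine Finset.sum_congr rfl fun σ _ => ?_
  have hpos : ∀ c ∈ word σ, 1 ≤ c := fun c hc => ((mem_word σ).1 hc).1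
  have hone : 1 ∈ word σ := (mem_word σ).2 (by omega)
  have hnd := nodup_word σ
  obtain ⟨a, l, hw⟩ := List.exists_cons_of_ne_nil (List.ne_nil_of_mem hone)
  rw [hw] at hpos hone hnd
  have := (prwWeight_eq x y z α a l hpos hone hnd).2
  rw [← hw] at this
  convert this.symm

open MvPolynomial in
/-- Lemma 3.1 of the paper: for the derivation `D` of `ℚ[a,x,y,z,α]`
(with `a = X 0`, `x = X 1`, `y = X 2`, `z = X 3`, `α = X 4`) determined by
`D(a) = a·α·(z+y)`, `D(x) = xy`, `D(y) = xy`, `D(z) = 0`, `D(α) = 0`, one has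
`Dⁿ(a) = a · ∑_{σ ∈ PRW_{n+1}} x^{des σ - LRmin σ + 1} y^{asc σ} z^{LRmin σ - 1}
α^{LRmin σ + RLmin σ - 2}`. -/
theorem grammar_binomialStirlingEulerian
    (D : Derivation ℚ (MvPolynomial (Fin 5) ℚ) (MvPolynomial (Fin 5) ℚ))
    (hDa : D (X 0) = X 0 * X 4 * (X 3 + X 2))
    (hDx : D (X 1) = X 1 * X 2) (hDy : D (X 2) = X 1 * X 2)
    (hDz : D (X 3) = 0) (hDα : D (X 4) = 0) (n : ℕ) :
    (D.toLinearMap ^ n) (X 0) =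
      X 0 * ∑ σ ∈ PRW (n + 1),
        (X 1 : MvPolynomial (Fin 5) ℚ) ^ (desW (word σ) + 1 - lrminW (word σ)) *
          X 2 ^ ascW (word σ) * X 3 ^ (lrminW (word σ) - 1) *
          X 4 ^ (lrminW (word σ) + rlminW (word σ) - 2) := by
  rw [sum_PRW_eq_sum_prwWeight]
  induction n with
  | zero => simp [word, prwWeight]
  | succ n ih =>
    rw [pow_succ', Module.End.mul_apply, ih, sum_prwWeight_word_succ D hDx hDy hDz hDα]
    change D _ = _
    rw [Derivation.leibniz, hDa, smul_eq_mul, smul_eq_mul]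
    ring
end

section
/- Let D̃ be the unique ℚ-linear derivation of the polynomial ring ℚ[a,u_1,u_2,u_3,u_4,u_5,α] in seven variables determined by D̃(a) = a·α·(u_3+u_5), D̃(u_1) = u_1·u_3, D̃(u_2) = u_2·u_4, D̃(u_3) = u_1·u_2, D̃(u_4) = u_1·u_2, D̃(u_5) = 0, D̃(α) = 0. Then for every n ≥ 0, D̃^n(a) = a · ∑_{σ∈PRW_{n+1}} (u_1 u_2)^{M(σ)} u_3^{da(σ)} u_4^{dd(σ)−LRmin(σ)+1} u_5^{LRmin(σ)−1} α^{LRmin(σ)+RLmin(σ)−2}. -/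
/-! ### Statistics of integer sequences with explicit boundary values -/

section Sequences

variable (f : ℕ → ℕ) (n : ℕ)

/-- Number of double ascents of `f` in `{1,…,n}`. -/
def seqDA : ℕ := ((Finset.Icc 1 n).filter fun i => f (i - 1) < f i ∧ f i < f (i + 1)).card

/-- Number of double descents of `f` in `{1,…,n}`. -/
def seqDD : ℕ := ((Finset.Icc 1 n).filter fun i => f i < f (i - 1) ∧ f (i + 1) < f i).card

/-- Number of peaks of `f` in `{1,…,n}`. -/
def seqPk : ℕ := ((Finset.Icc 1 n).filter fun i => f (i - 1) < f i ∧ f (i + 1) < f i).card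

/-- The value of `f` at `i` is a right-to-left minimum in `{1,…,n}`. -/
abbrev IsSeqRL (i : ℕ) : Prop := ∀ j ∈ Finset.Icc (i + 1) n, f i < f j

/-- Number of right-to-left minima of `f` in `{1,…,n}`. -/
def seqRL : ℕ := ((Finset.Icc 1 n).filter (IsSeqRL f n)).card

/-- The value of `f` at `i` is a left-to-right minimum, the boundary value `f 0` included
in the comparison. -/
abbrev IsSeqLR (i : ℕ) : Prop := ∀ j ∈ Finset.Icc 0 (i - 1), f i < f j

/-- Number of left-to-right minima of `f` in `{1,…,n}`, the boundary value `f 0` included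
in the comparison. -/
def seqLR : ℕ := ((Finset.Icc 1 n).filter (IsSeqLR f)).card

/-- The first ascent of `f` in `{1,…,n}`, if any, is at the value `1`. -/
abbrev SeqPRW : Prop :=
  ∀ i ∈ Finset.Icc 1 (n - 1), f i < f (i + 1) →
    (∀ j ∈ Finset.Icc 1 (i - 1), ¬ f j < f (j + 1)) → f i = 1

theorem card_filter_Icc_one_succ (P : ℕ → Prop) [DecidablePred P] :
    ((Finset.Icc 1 (n + 1)).filter P).card =
      (if P 1 then 1 else 0) + ((Finset.Icc 1 n).filter fun i => P (i + 1)).card := by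
  have h : Finset.Icc 1 (n + 1) = insert 1 ((Finset.Icc 1 n).map (addRightEmbedding 1)) := by
    ext i
    simp only [Finset.mem_Icc, Finset.mem_insert, Finset.mem_map, addRightEmbedding_apply]
    constructor
    · intro hi
      by_cases h1 : i = 1
      · exact Or.inl h1
      · exact Or.inr ⟨i - 1, by omega, by omega⟩
    · rintro (rfl | ⟨j, hj, rfl⟩) <;> omega
  rw [h, Finset.filter_insert, Finset.filter_map]
  have h1 : 1 ∉ (Finset.filter (P ∘ addRightEmbedding 1) (Finset.Icc 1 n)).map
      (addRightEmbedding 1) := by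
    simp
  split_ifs with hP
  · rw [Finset.card_insert_of_notMem h1, Finset.card_map, add_comm]
    rfl
  · rw [Finset.card_map, zero_add]
    rfl

theorem seqDA_succ : seqDA f (n + 1) =
    (if f 0 < f 1 ∧ f 1 < f 2 then 1 else 0) + seqDA (fun i => f (i + 1)) n := by
  unfold seqDA
  rw [card_filter_Icc_one_succ]
  congr 2
  refine Finset.filter_congr fun i hi => ?_
  obtain ⟨k, rfl⟩ := Nat.exists_eq_add_of_le' (Finset.mem_Icc.1 hi).1
  rfl

theorem seqDD_succ : seqDD f (n + 1) =
    (if f 1 < f 0 ∧ f 2 < f 1 then 1 else 0) + seqDD (fun i => f (i + 1)) n := by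
  unfold seqDD
  rw [card_filter_Icc_one_succ]
  congr 2
  refine Finset.filter_congr fun i hi => ?_
  obtain ⟨k, rfl⟩ := Nat.exists_eq_add_of_le' (Finset.mem_Icc.1 hi).1
  rfl

theorem seqPk_succ : seqPk f (n + 1) =
    (if f 0 < f 1 ∧ f 2 < f 1 then 1 else 0) + seqPk (fun i => f (i + 1)) n := by
  unfold seqPk
  rw [card_filter_Icc_one_succ]
  congr 2
  refine Finset.filter_congr fun i hi => ?_
  obtain ⟨k, rfl⟩ := Nat.exists_eq_add_of_le' (Finset.mem_Icc.1 hi).1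
  rfl

theorem forall_mem_Icc_succ_iff (a : ℕ) (P : ℕ → Prop) :
    (∀ j ∈ Finset.Icc (a + 1) (n + 1), P j) ↔ ∀ j ∈ Finset.Icc a n, P (j + 1) := by
  simp only [Finset.mem_Icc]
  constructor
  · intro h j hj
    exact h _ (by omega)
  · intro h j hj
    obtain ⟨k, rfl⟩ := Nat.exists_eq_add_of_le' (show 1 ≤ j by omega)
    exact h k (by omega)

theorem seqRL_succ : seqRL f (n + 1) =
    (if ∀ j ∈ Finset.Icc 1 n, (fun y => f 1 < y) (f (j + 1)) then 1 else 0) +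
      seqRL (fun i => f (i + 1)) n := by
  unfold seqRL
  rw [card_filter_Icc_one_succ]
  simp only [forall_mem_Icc_succ_iff]

theorem seqLR_succ (h : f 1 < f 0) : seqLR f (n + 1) = 1 + seqLR (fun i => f (i + 1)) n := by
  unfold seqLR
  rw [card_filter_Icc_one_succ, if_pos (by simpa [IsSeqLR] using h)]
  congr 2
  refine Finset.filter_congr fun i hi => ?_
  obtain ⟨k, rfl⟩ := Nat.exists_eq_add_of_le' (Finset.mem_Icc.1 hi).1
  simp only [IsSeqLR, Finset.mem_Icc, Nat.add_sub_cancel]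
  constructor
  · intro H j hj
    exact H _ (by omega)
  · intro H j hj
    rcases j with _ | j
    · exact lt_trans (H 0 (by omega)) h
    · exact H j (by omega)

theorem seqRL_pos (hn : 1 ≤ n) : 1 ≤ seqRL f n := by
  refine Finset.card_pos.2 ⟨n, Finset.mem_filter.2 ⟨Finset.mem_Icc.2 ⟨hn, le_rfl⟩, ?_⟩⟩
  simp [IsSeqRL]

theorem seqLR_eq_zero (h : ∀ i ∈ Finset.Icc 1 n, f 0 ≤ f i) : seqLR f n = 0 := by
  unfold seqLR
  rw [Finset.card_eq_zero, Finset.filter_eq_empty_iff]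
  intro i hi H
  exact absurd (H 0 (by simp)) (not_lt.2 (h i hi))

theorem seqPRW_of_one (h : f 1 = 1) (h2 : f 1 < f 2) : SeqPRW f n := by
  intro i hi _ hno
  by_cases hi1 : i = 1
  · rw [hi1, h]
  · have := Finset.mem_Icc.1 hi
    exact absurd h2 (hno 1 (Finset.mem_Icc.2 (by omega)))

theorem not_seqPRW (h : f 1 ≠ 1) (hn : 2 ≤ n) (h2 : f 1 < f 2) : ¬ SeqPRW f n := by
  intro H
  exact h (H 1 (Finset.mem_Icc.2 (by omega)) h2 (by simp))

theorem seqPRW_succ (h : f 2 < f 1) : SeqPRW f (n + 1) ↔ SeqPRW (fun i => f (i + 1)) n := by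
  simp only [SeqPRW, Finset.mem_Icc]
  constructor
  · intro H i hi hlt hno
    refine H (i + 1) (by omega) hlt fun j hj => ?_
    obtain ⟨k, rfl⟩ := Nat.exists_eq_add_of_le' hj.1
    rcases k with _ | k
    · exact not_lt_of_gt h
    · exact hno (k + 1) (by omega)
  · intro H i hi hlt hno
    obtain ⟨k, rfl⟩ := Nat.exists_eq_add_of_le' hi.1
    rcases k with _ | k
    · exact absurd hlt (not_lt_of_gt h)
    · exact H (k + 1) (by omega) hlt fun j hj => hno (j + 1) (by omega)

end Sequences

/-- The word `l` as a sequence, with value `p` at position `0` and `q` after the end. -/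
def boundedSeq : ℕ → ℕ → List ℕ → ℕ → ℕ
  | p, _, _, 0 => p
  | _, q, [], _ + 1 => q
  | _, q, x :: l, i + 1 => boundedSeq x q l i

theorem boundedSeq_zero (p q : ℕ) (l : List ℕ) : boundedSeq p q l 0 = p := by
  cases l <;> rfl

theorem boundedSeq_cons_succ (p q x : ℕ) (l : List ℕ) (i : ℕ) :
    boundedSeq p q (x :: l) (i + 1) = boundedSeq x q l i := rfl

theorem forall_boundedSeq_iff (P : ℕ → Prop) (p q : ℕ) (l : List ℕ) :
    (∀ j ∈ Finset.Icc 1 l.length, P (boundedSeq p q l j)) ↔ ∀ y ∈ l, P y := by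
  induction l generalizing p with
  | nil => simp
  | cons x l ih =>
    rw [List.forall_mem_cons, ← ih x, List.length_cons, forall_mem_Icc_succ_iff]
    simp only [boundedSeq_cons_succ, Finset.mem_Icc]
    constructor
    · intro h
      exact ⟨by simpa [boundedSeq_zero] using h 0 (by omega), fun j hj => h j (by omega)⟩
    · rintro ⟨h0, h⟩ j hj
      rcases j with _ | j
      · simpa [boundedSeq_zero] using h0
      · exact h _ (by omega)

theorem boundedSeq_succ (p q : ℕ) (l : List ℕ) (i : ℕ) :
    boundedSeq p q l (i + 1) = if i < l.length then l.getD i 0 else q := by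
  induction l generalizing p i with
  | nil => rfl
  | cons x l ih =>
    rw [boundedSeq_cons_succ]
    rcases i with _ | i
    · simp [boundedSeq_zero]
    · simp [ih]

theorem wB_eq_boundedSeq (w : List ℕ) : wB w = boundedSeq (w.length + 1) (w.length + 1) w := by
  funext i
  rcases i with _ | i
  · simp [wB, boundedSeq_zero]
  · rw [boundedSeq_succ, wB]
    simp

/-! ### Recursive weights of words -/

section Weights

variable {R : Type*} [CommRing R]

/-- Weight of a letter, given whether it is entered and left by an ascent. -/
def letterWt (v s t : R) : Bool → Bool → R
  | true, true => s
  | true, false => v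
  | false, true => 1
  | false, false => t

/-- Whether the letter `x` is followed by an ascent in `x :: l` (with `+∞` at the end). -/
def ascNext (x : ℕ) : List ℕ → Bool
  | [] => true
  | y :: _ => decide (x < y)

/-- Product of the letter weights of a word, with a factor `α` for every right-to-left minimum;
the boolean tells whether the first letter is entered by an ascent. -/
def tailWt (v s t α : R) : Bool → List ℕ → R
  | _, [] => 1
  | b, x :: l => letterWt v s t b (ascNext x l) * (if ∀ y ∈ l, x < y then α else 1) *
      tailWt v s t α (ascNext x l) l

/-- Weight of a word whose first ascent is at the letter `1`, and `0` for other words. -/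
def prwWt (v s t c α : R) : List ℕ → R
  | [] => 0
  | x :: l => if x = 1 then tailWt v s t α true l
      else if ascNext x l then 0 else c * α * prwWt v s t c α l

theorem ascNext_eq (x q : ℕ) (l : List ℕ) (hq : x < q) :
    ascNext x l = decide (x < boundedSeq x q l 1) := by
  rcases l with _ | ⟨y, l⟩
  · simp [ascNext, boundedSeq, hq]
  · simp [ascNext, boundedSeq_cons_succ, boundedSeq_zero]

theorem boundedSeq_one_ne (x q : ℕ) (l : List ℕ) (hq : x < q) (hx : x ∉ l) :
    boundedSeq x q l 1 ≠ x := by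
  rcases l with _ | ⟨y, l⟩
  · simpa [boundedSeq] using hq.ne'
  · simp only [List.mem_cons, not_or] at hx
    rw [boundedSeq_cons_succ, boundedSeq_zero]
    exact Ne.symm hx.1

theorem tailWt_eq (v s t α : R) (p q : ℕ) (l : List ℕ) (hl : (p :: l).Nodup)
    (hq : ∀ y ∈ l, y < q) :
    tailWt v s t α (decide (p < boundedSeq p q l 1)) l =
      v ^ seqPk (boundedSeq p q l) l.length * s ^ seqDA (boundedSeq p q l) l.length *
        t ^ seqDD (boundedSeq p q l) l.length * α ^ seqRL (boundedSeq p q l) l.length := by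
  induction l generalizing p with
  | nil => simp [tailWt, seqPk, seqDA, seqDD, seqRL]
  | cons x l ih =>
    obtain ⟨hp, hl⟩ := List.nodup_cons.1 hl
    obtain ⟨hx, -⟩ := List.nodup_cons.1 hl
    rw [List.forall_mem_cons] at hq
    have hne := boundedSeq_one_ne x q l hq.1 hx
    have hpx : p ≠ x := fun h => hp (by simp [h])
    rw [tailWt, ascNext_eq x q l hq.1, ih x hl hq.2, List.length_cons, seqPk_succ, seqDA_succ,
      seqDD_succ, seqRL_succ]
    simp only [boundedSeq_cons_succ, boundedSeq_zero, forall_boundedSeq_iff (fun y => x < y),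
      show boundedSeq p q (x :: l) 2 = boundedSeq x q l 1 from rfl,
      show boundedSeq p q (x :: l) 1 = boundedSeq x q l 0 from rfl]
    rcases lt_or_gt_of_ne hpx with h1 | h1 <;> rcases lt_or_gt_of_ne hne with h2 | h2 <;>
      split_ifs <;> simp_all [letterWt, not_lt_of_gt] <;> ring

theorem prwWt_eq (v s t c α : R) (p q : ℕ) (l : List ℕ) (hl : l.Nodup) (h1 : 1 ∈ l)
    (hpos : ∀ y ∈ l, 1 ≤ y) (hq : ∀ y ∈ l, y < q) (hp : boundedSeq p q l 1 < p) :
    prwWt v s t c α l = if SeqPRW (boundedSeq p q l) l.length then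
      v ^ seqPk (boundedSeq p q l) l.length * s ^ seqDA (boundedSeq p q l) l.length *
        t ^ (seqDD (boundedSeq p q l) l.length + 1 - seqLR (boundedSeq p q l) l.length) *
        c ^ (seqLR (boundedSeq p q l) l.length - 1) *
        α ^ (seqLR (boundedSeq p q l) l.length + seqRL (boundedSeq p q l) l.length - 2)
      else 0 := by
  induction l generalizing p with
  | nil => simp at h1
  | cons x l ih =>
    have hl' := List.nodup_cons.1 hl
    have hpos' := List.forall_mem_cons.1 hpos
    have hq' := List.forall_mem_cons.1 hq
    have e1 : boundedSeq p q (x :: l) 1 = x := by rw [boundedSeq_cons_succ, boundedSeq_zero]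
    have e2 : boundedSeq p q (x :: l) 2 = boundedSeq x q l 1 := rfl
    have es : (fun i => boundedSeq p q (x :: l) (i + 1)) = boundedSeq x q l := rfl
    rw [e1] at hp
    have hne := boundedSeq_one_ne x q l hq'.1 hl'.1
    rw [List.length_cons, seqLR_succ _ _ (by rwa [e1, boundedSeq_zero]), seqRL_succ, seqPk_succ,
      seqDA_succ, seqDD_succ, es]
    simp only [e1, e2, boundedSeq_zero, boundedSeq_cons_succ,
      forall_boundedSeq_iff (fun y => x < y)]
    by_cases hx : x = 1
    · subst hx
      have hlt : ∀ y ∈ l, 1 < y := fun y hy =>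
        lt_of_le_of_ne (hpos'.2 y hy) (by rintro rfl; exact hl'.1 hy)
      have h2 : 1 < boundedSeq 1 q l 1 := by
        rcases l with _ | ⟨y, l⟩
        · exact hq'.1
        · rw [boundedSeq_cons_succ, boundedSeq_zero]
          exact hlt y (by simp)
      have h0 : seqLR (boundedSeq 1 q l) l.length = 0 := by
        apply seqLR_eq_zero
        rw [boundedSeq_zero]
        exact (forall_boundedSeq_iff (fun y => 1 ≤ y) 1 q l).2 hpos'.2
      have ht := tailWt_eq v s t α 1 q l hl hq'.2
      rw [decide_eq_true h2] at ht
      rw [if_pos (seqPRW_of_one _ _ e1 (by rwa [e1, e2])), h0, if_pos hlt, prwWt, if_pos rfl, ht,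
        if_neg (by omega), if_neg (by omega), if_neg (by omega)]
      simp [← add_assoc]
    · have h1l : 1 ∈ l := by
        rcases List.mem_cons.1 h1 with h | h
        · exact absurd h.symm hx
        · exact h
      have hxlt : ¬ ∀ y ∈ l, x < y := fun h => by
        have := h 1 h1l
        omega
      have hlen : 1 ≤ l.length := List.length_pos_of_mem h1l
      rw [prwWt, if_neg hx, ascNext_eq x q l hq'.1, if_neg hxlt]
      rcases lt_or_gt_of_ne hne with h2 | h2
      · have hRL := seqRL_pos (boundedSeq x q l) l.length hlen
        have hLR : 1 ≤ seqLR (boundedSeq x q l) l.length := by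
          obtain ⟨k, hk⟩ := Nat.exists_eq_add_of_le' hlen
          rw [hk, seqLR_succ _ _ (by rwa [boundedSeq_zero])]
          omega
        have hP := seqPRW_succ (boundedSeq p q (x :: l)) l.length (by rwa [e1, e2])
        rw [es] at hP
        simp only [hP, ih x hl'.2 h1l hpos'.2 hq'.2 h2, hp, h2, not_lt_of_gt h2, not_lt_of_gt hp,
          decide_false, and_self, false_and, if_true, if_false, Bool.false_eq_true]
        obtain ⟨a, ha⟩ := Nat.exists_eq_add_of_le' hLR
        obtain ⟨b, hb⟩ := Nat.exists_eq_add_of_le' hRL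
        rw [ha, hb]
        split_ifs
        · rw [show 1 + (a + 1) - 1 = a + 1 by omega, show a + 1 - 1 = a by omega,
            show a + 1 + (b + 1) - 2 = a + b by omega,
            show 1 + (a + 1) + (0 + (b + 1)) - 2 = a + b + 1 by omega,
            show ∀ d, 1 + d + 1 - (1 + (a + 1)) = d + 1 - (a + 1) by omega]
          ring
        · ring
      · have hP := not_seqPRW (boundedSeq p q (x :: l)) (l.length + 1) (by rwa [e1]) (by omega)
          (by rwa [e1, e2])
        rw [if_neg hP, decide_eq_true h2, if_pos rfl]

theorem forall_mem_lt_of_mem_permutations'Aux {N x : ℕ} {l l' : List ℕ} (hx : x < N)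
    (h : l' ∈ List.permutations'Aux N l) : (∀ y ∈ l', x < y) ↔ ∀ y ∈ l, x < y := by
  have hp : l'.Perm (N :: l) := by
    rw [← List.mem_permutations', List.permutations', List.mem_flatMap]
    exact ⟨l, List.mem_permutations'.2 (List.Perm.refl l), h⟩
  simp [hp.mem_iff, hx]

variable [Algebra ℚ R] (D : Derivation ℚ R R) {v s t c α : R}

theorem sum_tailWt_insert (hv : D v = v * (s + t)) (hs : D s = v) (ht : D t = v) (hα : D α = 0)
    (N : ℕ) (b : Bool) (x : ℕ) (l : List ℕ) (hN : ∀ y ∈ x :: l, y < N) :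
    ((List.permutations'Aux N l).map fun l' => tailWt v s t α b (x :: l')).sum =
      D (tailWt v s t α b (x :: l)) + α * s * tailWt v s t α b (x :: l) -
        (if b then v * tailWt v s t α false (x :: l) else 0) := by
  induction l generalizing b x with
  | nil =>
    have hx : x < N := hN x (by simp)
    cases b <;> simp [tailWt, letterWt, ascNext, hx, hs, hα, Derivation.leibniz] <;> ring
  | cons y l ih =>
    obtain ⟨hx, hyl⟩ := List.forall_mem_cons.1 hN
    have hy : y < N := hyl y (by simp)
    have ih' := ih (decide (x < y)) y hyl
    set r : R := if ∀ z ∈ y :: l, x < z then α else 1 with hr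
    have hDr : D r = 0 := by
      rw [hr]
      split_ifs <;> simp [hα]
    have e1 : tailWt v s t α b (x :: N :: y :: l) =
        letterWt v s t b true * r * (v * tailWt v s t α false (y :: l)) := by
      have h1 : ¬ N < y := by omega
      rw [tailWt, tailWt.eq_2 v s t α _ N (y :: l), hr]
      simp [ascNext, hx, h1, letterWt]
    have e2 : ∀ l' ∈ List.permutations'Aux N l, tailWt v s t α b (x :: y :: l') =
        letterWt v s t b (decide (x < y)) * r * tailWt v s t α (decide (x < y)) (y :: l') := by
      intro l' hl'
      rw [tailWt, hr]
      simp only [List.forall_mem_cons, forall_mem_lt_of_mem_permutations'Aux hx hl', ascNext]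
    have e3 : ∀ b, tailWt v s t α b (x :: y :: l) =
        letterWt v s t b (decide (x < y)) * r * tailWt v s t α (decide (x < y)) (y :: l) := by
      intro b
      rw [tailWt, hr]
      rfl
    rw [List.permutations'Aux, List.map_cons, List.sum_cons, e1, List.map_map, Function.comp_def,
      List.map_congr_left (g := fun l' => letterWt v s t b (decide (x < y)) * r *
        tailWt v s t α (decide (x < y)) (y :: l')) e2, List.sum_map_mul_left, ih', e3, e3]
    generalize decide (x < y) = d
    rw [Derivation.leibniz, Derivation.leibniz, hDr]
    cases b <;> cases d <;> simp [letterWt, hv, hs, ht] <;> ring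

theorem sum_tailWt_permutations'Aux (hv : D v = v * (s + t)) (hs : D s = v) (ht : D t = v)
    (hα : D α = 0) (N : ℕ) (l : List ℕ) (hN : ∀ y ∈ l, y < N) :
    ((List.permutations'Aux N l).map (tailWt v s t α true)).sum =
      D (tailWt v s t α true l) + α * s * tailWt v s t α true l := by
  rcases l with _ | ⟨y, l⟩
  · simp [tailWt, letterWt, ascNext]
    ring
  · have hy : ¬ N < y := not_lt_of_gt (hN y (by simp))
    have e : tailWt v s t α true (N :: y :: l) = v * tailWt v s t α false (y :: l) := by
      rw [tailWt]
      simp [ascNext, letterWt, hy]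
    rw [List.permutations'Aux, List.map_cons, List.sum_cons, e, List.map_map]
    have := sum_tailWt_insert D hv hs ht hα N true y l hN
    rw [if_pos rfl] at this
    simp only [Function.comp_def, this]
    ring

theorem sum_prwWt_permutations'Aux (hv : D v = v * (s + t)) (hs : D s = v) (ht : D t = v)
    (hc : D c = 0) (hα : D α = 0) (N : ℕ) (hN1 : 1 < N) (l : List ℕ) (hN : ∀ y ∈ l, y < N) :
    ((List.permutations'Aux N l).map (prwWt v s t c α)).sum =
      D (prwWt v s t c α l) + α * (s + c) * prwWt v s t c α l := by
  induction l with
  | nil => simp [prwWt, hN1.ne', ascNext]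
  | cons x l ih =>
    obtain ⟨hx, hl⟩ := List.forall_mem_cons.1 hN
    have e : prwWt v s t c α (N :: x :: l) = c * α * prwWt v s t c α (x :: l) := by
      rw [prwWt, if_neg hN1.ne']
      simp [ascNext, hx.le]
    rw [List.permutations'Aux, List.map_cons, List.sum_cons, e, List.map_map]
    by_cases hx1 : x = 1
    · have e' : ∀ l', prwWt v s t c α (x :: l') = tailWt v s t α true l' := fun l' => by
        rw [prwWt, if_pos hx1]
      simp only [Function.comp_def, e', sum_tailWt_permutations'Aux D hv hs ht hα N l hl]
      ring
    · rcases l with _ | ⟨y, l⟩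
      · simp [prwWt, hx1, ascNext, hx]
      · have hy : y < N := hl y (by simp)
        have e1 : prwWt v s t c α (x :: N :: y :: l) = 0 := by
          rw [prwWt, if_neg hx1]
          simp [ascNext, hx]
        have e2 : ∀ l', prwWt v s t c α (x :: y :: l') =
            (if x < y then 0 else c * α) * prwWt v s t c α (y :: l') := fun l' => by
          rw [prwWt, if_neg hx1]
          by_cases h : x < y <;> simp [ascNext, h]
        have e3 : prwWt v s t c α (N :: y :: l) = c * α * prwWt v s t c α (y :: l) := by
          rw [prwWt, if_neg hN1.ne']
          simp [ascNext, hy.le]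
        have ih' := ih hl
        rw [List.permutations'Aux, List.map_cons, List.sum_cons, e3, List.map_map] at ih'
        rw [List.permutations'Aux, List.map_cons, List.sum_cons, List.map_map]
        simp only [Function.comp_def, e1, e2, List.sum_map_mul_left] at ih' ⊢
        rw [eq_sub_of_add_eq' ih', Derivation.leibniz]
        split_ifs
        · simp
        · rw [Derivation.leibniz, hc, hα]
          simp only [smul_eq_mul]
          ring

end Weights

/-! ### Permutations as words -/

/-- The word `n ⋯ 2 1`. -/
def descWord : ℕ → List ℕ
  | 0 => []
  | n + 1 => (n + 1) :: descWord n

theorem mem_descWord {n y : ℕ} : y ∈ descWord n ↔ 1 ≤ y ∧ y ≤ n := by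
  induction n with
  | zero =>
    simp only [descWord, List.not_mem_nil, false_iff]
    omega
  | succ n ih =>
    rw [descWord, List.mem_cons, ih]
    omega

theorem nodup_descWord (n : ℕ) : (descWord n).Nodup := by
  induction n with
  | zero => simp [descWord]
  | succ n ih =>
    rw [descWord, List.nodup_cons, mem_descWord]
    exact ⟨by omega, ih⟩

theorem length_descWord (n : ℕ) : (descWord n).length = n := by
  induction n with
  | zero => rfl
  | succ n ih => rw [descWord, List.length_cons, ih]

theorem word_injective (n : ℕ) : Function.Injective (word (n := n)) := by
  intro σ τ h
  have := List.ofFn_injective h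
  ext i
  simpa using congrFun this i

theorem word_perm_descWord {n : ℕ} (σ : Equiv.Perm (Fin n)) : (word σ).Perm (descWord n) := by
  refine (List.perm_ext_iff_of_nodup ?_ (nodup_descWord n)).2 fun y => ?_
  · refine List.nodup_ofFn.2 fun i j h => ?_
    simpa [Fin.val_inj] using h
  · rw [mem_descWord, word, List.mem_ofFn]
    constructor
    · rintro ⟨i, rfl⟩
      exact ⟨by omega, (σ i).isLt⟩
    · rintro ⟨h1, h2⟩
      exact ⟨σ.symm ⟨y - 1, by omega⟩, by simp; omega⟩

theorem sum_perm_word {M : Type*} [AddCommMonoid M] (n : ℕ) (g : List ℕ → M) :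
    ∑ σ : Equiv.Perm (Fin n), g (word σ) = ((descWord n).permutations'.map g).sum := by
  have hnd : (descWord n).permutations'.Nodup :=
    (List.permutations_perm_permutations' _).nodup_iff.1 (List.nodup_permutations _ (nodup_descWord n))
  have h : Finset.univ.image (word (n := n)) = (descWord n).permutations'.toFinset := by
    refine Finset.eq_of_subset_of_card_le ?_ ?_
    · intro l hl
      obtain ⟨σ, -, rfl⟩ := Finset.mem_image.1 hl
      rw [List.mem_toFinset, List.mem_permutations']
      exact word_perm_descWord σ
    · rw [List.toFinset_card_of_nodup hnd, Finset.card_image_of_injective _ (word_injective n),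
        ← (List.permutations_perm_permutations' _).length_eq, List.length_permutations,
        length_descWord, Finset.card_univ, Fintype.card_perm, Fintype.card_fin]
  rw [← List.sum_toFinset _ hnd, ← h, Finset.sum_image (word_injective n).injOn]

theorem sum_PRW {R : Type*} [CommRing R] (v s t c α : R) (n : ℕ) :
    ∑ σ ∈ PRW (n + 1), v ^ pkW (word σ) * s ^ daW (word σ) *
        t ^ (ddW (word σ) + 1 - lrminW (word σ)) * c ^ (lrminW (word σ) - 1) *
        α ^ (lrminW (word σ) + rlminW (word σ) - 2) =
      ((descWord (n + 1)).permutations'.map (prwWt v s t c α)).sum := by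
  rw [← sum_perm_word, PRW, Finset.sum_filter]
  refine Finset.sum_congr rfl fun σ _ => ?_
  have hp := word_perm_descWord σ
  have hlen : (word σ).length = n + 1 := by rw [hp.length_eq, length_descWord]
  have hmem : ∀ y ∈ word σ, 1 ≤ y ∧ y < (word σ).length + 1 := fun y hy => by
    have := mem_descWord.1 (hp.mem_iff.1 hy)
    omega
  have hlt : ∀ i ∈ Finset.Icc 1 (word σ).length, wB (word σ) i < (word σ).length + 1 := by
    rw [wB_eq_boundedSeq]
    exact (forall_boundedSeq_iff (fun y => y < (word σ).length + 1) _ _ _).2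
      fun y hy => (hmem y hy).2
  have hLR : lrminW (word σ) = seqLR (wB (word σ)) (word σ).length := by
    unfold lrminW seqLR
    congr 1
    refine Finset.filter_congr fun i hi => ?_
    simp only [isLRat, IsSeqLR, Finset.mem_Icc]
    constructor
    · intro H j hj
      rcases j with _ | j
      · exact hlt i hi
      · exact H _ (by omega)
    · intro H j hj
      exact H j (by omega)
  have key := prwWt_eq v s t c α ((word σ).length + 1) ((word σ).length + 1) (word σ)
    (hp.nodup_iff.2 (nodup_descWord _)) (hp.mem_iff.2 (mem_descWord.2 (by omega)))
    (fun y hy => (hmem y hy).1) (fun y hy => (hmem y hy).2)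
    (by rw [← wB_eq_boundedSeq]; exact hlt 1 (Finset.mem_Icc.2 (by omega)))
  rw [← wB_eq_boundedSeq, ← hLR] at key
  exact key.symm

theorem sum_prwWt_succ {R : Type*} [CommRing R] [Algebra ℚ R] (D : Derivation ℚ R R)
    {v s t c α : R} (hv : D v = v * (s + t)) (hs : D s = v) (ht : D t = v)
    (hc : D c = 0) (hα : D α = 0) (n : ℕ) :
    ((descWord (n + 2)).permutations'.map (prwWt v s t c α)).sum =
      D ((descWord (n + 1)).permutations'.map (prwWt v s t c α)).sum +
        α * (s + c) * ((descWord (n + 1)).permutations'.map (prwWt v s t c α)).sum := by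
  have hmain : ∀ L : List (List ℕ), (∀ l ∈ L, ∀ y ∈ l, y < n + 2) →
      ((L.flatMap (List.permutations'Aux (n + 2))).map (prwWt v s t c α)).sum =
        D (L.map (prwWt v s t c α)).sum + α * (s + c) * (L.map (prwWt v s t c α)).sum := by
    intro L hL
    induction L with
    | nil => simp
    | cons l L ih =>
      obtain ⟨hl, hL⟩ := List.forall_mem_cons.1 hL
      rw [List.flatMap_cons, List.map_append, List.sum_append, ih hL,
        sum_prwWt_permutations'Aux D hv hs ht hc hα (n + 2) (by omega) l hl, List.map_cons,
        List.sum_cons, map_add]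
      ring
  rw [descWord, List.permutations']
  refine hmain _ fun l hl y hy => ?_
  have := mem_descWord.1 ((List.mem_permutations'.1 hl).mem_iff.1 hy)
  omega

open MvPolynomial in
/-- Lemma 3.2 of the paper: for the derivation `D̃` of
`ℚ[a,u₁,u₂,u₃,u₄,u₅,α]` (with `a = X 0`, `uᵢ = X i` for `1 ≤ i ≤ 5`, `α = X 6`)
determined by `D̃(a) = a·α·(u₃+u₅)`, `D̃(u₁) = u₁u₃`, `D̃(u₂) = u₂u₄`, `D̃(u₃) = u₁u₂`,
`D̃(u₄) = u₁u₂`, `D̃(u₅) = 0`, `D̃(α) = 0`, one has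
`D̃ⁿ(a) = a · ∑_{σ ∈ PRW_{n+1}} (u₁u₂)^{M σ} u₃^{da σ} u₄^{dd σ - LRmin σ + 1}
u₅^{LRmin σ - 1} α^{LRmin σ + RLmin σ - 2}`. -/
theorem grammar_binomialStirlingEulerian_refined
    (D : Derivation ℚ (MvPolynomial (Fin 7) ℚ) (MvPolynomial (Fin 7) ℚ))
    (hDa : D (X 0) = X 0 * X 6 * (X 3 + X 5))
    (hDu₁ : D (X 1) = X 1 * X 3) (hDu₂ : D (X 2) = X 2 * X 4)
    (hDu₃ : D (X 3) = X 1 * X 2) (hDu₄ : D (X 4) = X 1 * X 2)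
    (hDu₅ : D (X 5) = 0) (hDα : D (X 6) = 0) (n : ℕ) :
    (D.toLinearMap ^ n) (X 0) =
      X 0 * ∑ σ ∈ PRW (n + 1),
        ((X 1 : MvPolynomial (Fin 7) ℚ) * X 2) ^ pkW (word σ) *
          X 3 ^ daW (word σ) * X 4 ^ (ddW (word σ) + 1 - lrminW (word σ)) *
          X 5 ^ (lrminW (word σ) - 1) *
          X 6 ^ (lrminW (word σ) + rlminW (word σ) - 2) := by
  rw [sum_PRW]
  have hv : D (X 1 * X 2) = X 1 * X 2 * (X 3 + X 4) := by
    rw [Derivation.leibniz, hDu₁, hDu₂, smul_eq_mul, smul_eq_mul]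
    ring
  induction n with
  | zero => simp [descWord, prwWt, tailWt]
  | succ n ih =>
    rw [pow_succ', Module.End.mul_apply, ih, sum_prwWt_succ D hv hDu₃ hDu₄ hDu₅ hDα,
      Derivation.coeFn_coe, Derivation.leibniz, hDa, smul_eq_mul, smul_eq_mul]
    ring
end
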